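/- (Proposition 3.3) Let f : 𝕎 → ℍ be an M-bilipschitz map, M ≥ 1. For every ε ∈ (0,1] and C ≥ 1 there exists a constant C' > 0, depending only on C, ε and M, such that Σ_{Q ∈ 𝒟, Q ⊂ Q₀, ρ_f(CQ) ≥ ε} ℓ(Q)³ ≤ C'·ℓ(Q₀)³ for every Q₀ ∈ 𝒟. -/

import Mathlib

open scoped ENNReal

namespace HeisRug

/-- The first Heisenberg group, as a set: ℝ³. -/
abbrev Hei : Type := ℝ × ℝ × ℝ

/-- Heisenberg group multiplication. -/
noncomputable def Hmul (p q : Hei) : Hei :=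
  (p.1 + q.1, p.2.1 + q.2.1, p.2.2 + q.2.2 + (p.1 * q.2.1 - q.1 * p.2.1) / 2)

/-- Heisenberg group inverse. -/
def Hinv (p : Hei) : Hei := (-p.1, -p.2.1, -p.2.2)

/-- Homogeneous norm on the Heisenberg group. -/
noncomputable def Hnorm (p : Hei) : ℝ :=
  max (Real.sqrt (p.1 ^ 2 + p.2.1 ^ 2)) (Real.sqrt |p.2.2|)

/-- Left-invariant metric `d(p,q) = ‖q⁻¹·p‖` on the Heisenberg group. -/
noncomputable def dH (p q : Hei) : ℝ := Hnorm (Hmul (Hinv q) p)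

/-- Parabolic metric on the parabolic plane 𝕎 = ℝ². -/
noncomputable def dPar (w w' : ℝ × ℝ) : ℝ :=
  max |w.1 - w'.1| (Real.sqrt |w.2 - w'.2|)

/-- Distance from a point to a set in (ℍ, d). -/
noncomputable def distH (p : Hei) (E : Set Hei) : ℝ := sInf ((dH p) '' E)

/-- Closed δ-neighbourhood of a set in ℍ. -/
def NH (E : Set Hei) (δ : ℝ) : Set Hei := {p | distH p E ≤ δ}

/-- Closed ball in (ℍ, d). -/
def BH (p : Hei) (r : ℝ) : Set Hei := {q | dH q p ≤ r}

/-- Closed parabolic ball in 𝕎. -/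
def BPar (w : ℝ × ℝ) (r : ℝ) : Set (ℝ × ℝ) := {v | dPar v w ≤ r}

/-- Diameter (in ℝ≥0∞) with respect to the Heisenberg metric. -/
noncomputable def ediamH (E : Set Hei) : ℝ≥0∞ :=
  ⨆ p ∈ E, ⨆ q ∈ E, ENNReal.ofReal (dH p q)

/-- The 3-dimensional Hausdorff measure on (ℍ, d), as a set function. -/
noncomputable def H3 (E : Set Hei) : ℝ≥0∞ :=
  ⨆ (δ : ℝ≥0∞) (_ : 0 < δ),
    ⨅ (U : ℕ → Set Hei) (_ : E ⊆ ⋃ n, U n) (_ : ∀ n, ediamH (U n) ≤ δ),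
      ∑' n, ediamH (U n) ^ 3

/-- Isometric embedding of the parabolic plane onto the subgroup 𝕎 ⊂ ℍ. -/
def embedW (w : ℝ × ℝ) : Hei := (0, w.1, w.2)

/-- The vertical subgroup 𝕎 = {(0,y,t)} of ℍ. -/
def Wsub : Set Hei := {p | p.1 = 0}

/-- Rotation by angle θ about the t-axis. -/
noncomputable def Rrot (θ : ℝ) (p : Hei) : Hei :=
  (p.1 * Real.cos θ - p.2.1 * Real.sin θ, p.1 * Real.sin θ + p.2.1 * Real.cos θ, p.2.2)

/-- Vertical projection Π : ℍ → 𝕎. -/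
noncomputable def Piproj (p : Hei) : Hei := (0, p.2.1, p.2.2 + p.1 * p.2.1 / 2)

/-- Horizontal projection Π_𝕃 : ℍ → 𝕃. -/
def PiL (p : Hei) : Hei := (p.1, 0, 0)

/-- Vertical projection Π_θ = R_θ ∘ Π ∘ R_θ⁻¹ onto 𝕎_θ. -/
noncomputable def PiTheta (θ : ℝ) (p : Hei) : Hei := Rrot θ (Piproj (Rrot (-θ) p))

/-- `f : 𝕎 → ℍ` is M-bilipschitz. -/
def IsBilipschitz (M : ℝ) (f : ℝ × ℝ → Hei) : Prop :=
  ∀ w w' : ℝ × ℝ,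
    M⁻¹ * dPar w w' ≤ dH (f w) (f w') ∧ dH (f w) (f w') ≤ M * dPar w w'

/-- A Rickman rug: the image of the parabolic plane under a bilipschitz map. -/
def IsRickmanRug (E : Set Hei) : Prop :=
  ∃ M : ℝ, 1 ≤ M ∧ ∃ f : ℝ × ℝ → Hei, IsBilipschitz M f ∧ E = Set.range f

/-- A horizontal line in ℍ. -/
def IsHorizontalLine (L : Set Hei) : Prop :=
  ∃ p : Hei, ∃ v : ℝ × ℝ, v ≠ 0 ∧
    L = {q | ∃ s : ℝ, q = Hmul p (s * v.1, s * v.2, 0)}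

/-- The vertical plane spanned by a horizontal line. -/
def VSpan (L : Set Hei) : Set Hei := {q | ∃ p ∈ L, ∃ t : ℝ, q = Hmul p (0, 0, t)}

/-- Vertical planes in ℍ. -/
def IsVerticalPlane (V : Set Hei) : Prop :=
  ∃ L : Set Hei, IsHorizontalLine L ∧ V = VSpan L

/-- The horizontal line {(a·y + b, y, b·y/2 + c) : y ∈ ℝ} (of slope |a|). -/
def hline (a b c : ℝ) : Set Hei :=
  {p | ∃ y : ℝ, p = (a * y + b, y, b * y / 2 + c)}

/-- A horizontal line of (finite) slope at most Σ. -/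
def HLineSlopeLe (S : ℝ) (L : Set Hei) : Prop :=
  ∃ a b c : ℝ, |a| ≤ S ∧ L = hline a b c

/-- A vertical plane of (finite) slope at most Σ (relative to 𝕎). -/
def VPlaneSlopeLe (S : ℝ) (V : Set Hei) : Prop :=
  ∃ a b : ℝ, |a| ≤ S ∧ V = {p : Hei | p.1 = a * p.2.1 + b}

/-- A vertical plane whose slope relative to 𝕎_θ equals 0. -/
def SlopeZeroRel (θ : ℝ) (V : Set Hei) : Prop :=
  ∃ b : ℝ, Rrot (-θ) '' V = {p : Hei | p.1 = b}

/-- The horizontal line ℝ × {t} in the parabolic plane. -/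
def lineW (t : ℝ) : Set (ℝ × ℝ) := {w | w.2 = t}

/-- Ruler coefficient ρ_f(B_par(w,r)). -/
noncomputable def rulerCoef (f : ℝ × ℝ → Hei) (w : ℝ × ℝ) (r : ℝ) : ℝ :=
  sInf {ρ : ℝ | 0 < ρ ∧ ∀ t : ℝ, ∃ L : Set Hei, IsHorizontalLine L ∧
    f '' (lineW t ∩ BPar w r) ⊆ NH L (ρ * r)}

/-- β_f(𝕍; B_par(w,r)): approximation number relative to the vertical plane 𝕍. -/
noncomputable def betaV (f : ℝ × ℝ → Hei) (V : Set Hei) (w : ℝ × ℝ) (r : ℝ) : ℝ :=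
  sInf {ε : ℝ | 0 < ε ∧ ∀ t : ℝ, ∃ L : Set Hei, IsHorizontalLine L ∧ L ⊆ V ∧
    f '' (lineW t ∩ BPar w r) ⊆ NH L (ε * r)}

/-- The strong vertical β-number β_f(B_par(w,r)) = inf_𝕍 β_f(𝕍; B_par(w,r)). -/
noncomputable def beta (f : ℝ × ℝ → Hei) (w : ℝ × ℝ) (r : ℝ) : ℝ :=
  sInf {b : ℝ | ∃ V : Set Hei, IsVerticalPlane V ∧ b = betaV f V w r}

/-- Index set for dyadic parabolic rectangles: (n, k, l). -/
abbrev Idx : Type := ℤ × ℤ × ℤ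

/-- Side length ℓ(Q) = 2⁻ⁿ of the dyadic parabolic rectangle with index (n,k,l). -/
noncomputable def sideLen (i : Idx) : ℝ := (2 : ℝ) ^ (-i.1)

/-- The dyadic parabolic rectangle [k·2⁻ⁿ, (k+1)·2⁻ⁿ) × [l·4⁻ⁿ, (l+1)·4⁻ⁿ). -/
noncomputable def rect (i : Idx) : Set (ℝ × ℝ) :=
  Set.Ico ((i.2.1 : ℝ) * (2 : ℝ) ^ (-i.1)) (((i.2.1 : ℝ) + 1) * (2 : ℝ) ^ (-i.1)) ×ˢ
  Set.Ico ((i.2.2 : ℝ) * (4 : ℝ) ^ (-i.1)) (((i.2.2 : ℝ) + 1) * (4 : ℝ) ^ (-i.1))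

/-- The centre c_Q of a dyadic parabolic rectangle. -/
noncomputable def center (i : Idx) : ℝ × ℝ :=
  (((i.2.1 : ℝ) + 1 / 2) * (2 : ℝ) ^ (-i.1), ((i.2.2 : ℝ) + 1 / 2) * (4 : ℝ) ^ (-i.1))

/-- λQ := B_par(c_Q, λ·ℓ(Q)). -/
noncomputable def dilate (lam : ℝ) (i : Idx) : Set (ℝ × ℝ) := BPar (center i) (lam * sideLen i)

/-- j indexes a 𝒟-child of the rectangle indexed by i. -/
def IsChild (j i : Idx) : Prop := j.1 = i.1 + 1 ∧ rect j ⊆ rect i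

/-- T ⊆ 𝒟 is a tree with root rt. -/
def IsTreeWithRoot (T : Set Idx) (rt : Idx) : Prop :=
  rt ∈ T ∧ (∀ i ∈ T, rect i ⊆ rect rt) ∧
  (∀ i j k : Idx, i ∈ T → k ∈ T → rect i ⊆ rect j → rect j ⊆ rect k → j ∈ T) ∧
  (∀ i ∈ T, (∀ j : Idx, IsChild j i → j ∈ T) ∨ (∀ j : Idx, IsChild j i → j ∉ T))

/-- T ⊆ 𝒟 is a tree. -/
def IsTree (T : Set Idx) : Prop := ∃ rt : Idx, IsTreeWithRoot T rt

/-- Q is (ε,H,Σ)-vertical for f : there is a vertical plane 𝕍_Q of slope ≤ Σ with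
β_f(𝕍_Q; HQ) < ε/H. -/
def IsVerticalRect (f : ℝ × ℝ → Hei) (ε Hc S : ℝ) (i : Idx) : Prop :=
  ∃ V : Set Hei, VPlaneSlopeLe S V ∧ betaV f V (center i) (Hc * sideLen i) < ε / Hc

/-- Q is (δ,C)-ruled for f. -/
def IsRuled (f : ℝ × ℝ → Hei) (δ C : ℝ) (i : Idx) : Prop :=
  ∀ t : ℝ, ∃ L : Set Hei, IsHorizontalLine L ∧
    f '' (lineW t ∩ dilate C i) ⊆ NH L (δ * sideLen i)

/-- Q is (δ,C,Σ)-ruled for f. -/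
def IsRuledSlope (f : ℝ × ℝ → Hei) (δ C S : ℝ) (i : Idx) : Prop :=
  IsRuled f δ C i ∧ ∃ t : ℝ, (lineW t ∩ rect i).Nonempty ∧
    ∃ L : Set Hei, HLineSlopeLe S L ∧
      f '' (lineW t ∩ dilate C i) ⊆ NH L (δ * sideLen i)

/-- Γ is an intrinsic L-Lipschitz graph over 𝕎. -/
def IsIntrinsicLipGraph (L : ℝ) (Γ : Set Hei) : Prop :=
  Set.BijOn Piproj Γ Wsub ∧
  ∀ p ∈ Γ, ∀ q ∈ Γ,
    Hnorm (PiL (Hmul (Hinv q) p)) ≤ L * Hnorm (Piproj (Hmul (Hinv q) p))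

/-- Γ is an intrinsic L-Lipschitz graph over 𝕎_θ. -/
def IsIntrinsicLipGraphOver (θ L : ℝ) (Γ : Set Hei) : Prop :=
  IsIntrinsicLipGraph L (Rrot (-θ) '' Γ)

/-- An intrinsic bilipschitz graph: an intrinsic Lipschitz graph over some vertical
subgroup which is also a Rickman rug. -/
def IsIntrinsicBilipGraph (Γ : Set Hei) : Prop :=
  (∃ θ ∈ Set.Ico (-(Real.pi / 2)) (Real.pi / 2), ∃ L : ℝ, 1 ≤ L ∧
    IsIntrinsicLipGraphOver θ L Γ) ∧ IsRickmanRug Γ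

/-- (M,ε)-quasi-isometric embedding between sets with distance functions. -/
def IsQIEOn {X Y : Type*} (dX : X → X → ℝ) (dY : Y → Y → ℝ) (A : Set X)
    (M ε : ℝ) (F : X → Y) : Prop :=
  ∀ x ∈ A, ∀ x' ∈ A,
    M⁻¹ * dX x x' - ε ≤ dY (F x) (F x') ∧ dY (F x) (F x') ≤ M * dX x x' + ε

/-- d is a metric on ℝ. -/
def IsMetricOn (d : ℝ → ℝ → ℝ) : Prop :=
  (∀ x y, d x y = d y x) ∧ (∀ x y, d x y = 0 ↔ x = y) ∧
  (∀ x y z, d x z ≤ d x y + d y z)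

/-- d is an orderly metric on ℝ. -/
def Orderly (d : ℝ → ℝ → ℝ) : Prop :=
  IsMetricOn d ∧
  (∀ x : ℝ, ∀ ε > (0 : ℝ), ∃ δ > (0 : ℝ), ∀ y : ℝ, |x - y| < δ → d x y < ε) ∧
  (∀ x y z : ℝ, x ≤ y → y ≤ z → max (d x y) (d y z) ≤ d x z)

/-- F : I×J → 𝕎 is a horizontal (M,ε)-QIE. -/
def IsHorizQIE (M ε : ℝ) (I J : Set ℝ) (F : ℝ × ℝ → ℝ × ℝ) : Prop :=
  IsQIEOn dPar dPar (I ×ˢ J) M ε F ∧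
  (∀ t ∈ J, ∃ c : ℝ, ∀ y ∈ I, (F (y, t)).2 = c)


lemma Hnorm_le_of {p : Hei} {D : ℝ} (hD : 0 ≤ D) (h1 : p.1 ^ 2 + p.2.1 ^ 2 ≤ D ^ 2)
    (h2 : |p.2.2| ≤ D ^ 2) : Hnorm p ≤ D :=
  max_le (Real.sqrt_le_iff.2 ⟨hD, h1⟩) (Real.sqrt_le_iff.2 ⟨hD, h2⟩)

lemma Hnorm_nonneg (p : Hei) : 0 ≤ Hnorm p := le_max_of_le_left (Real.sqrt_nonneg _)

lemma Hnorm_le_imp {p : Hei} {D : ℝ} (h : Hnorm p ≤ D) :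
    p.1 ^ 2 + p.2.1 ^ 2 ≤ D ^ 2 ∧ |p.2.2| ≤ D ^ 2 :=
  ⟨(Real.sqrt_le_iff.1 ((le_max_left _ _).trans h)).2,
    (Real.sqrt_le_iff.1 ((le_max_right _ _).trans h)).2⟩

lemma Hnorm_mul_le (p q : Hei) : Hnorm (Hmul p q) ≤ Hnorm p + Hnorm q := by
  obtain ⟨a1, a2, a3⟩ := p
  obtain ⟨b1, b2, b3⟩ := q
  obtain ⟨hp1, hp2⟩ := Hnorm_le_imp (le_refl (Hnorm (a1, a2, a3)))
  obtain ⟨hq1, hq2⟩ := Hnorm_le_imp (le_refl (Hnorm (b1, b2, b3)))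
  have hA := Hnorm_nonneg (a1, a2, a3)
  have hB := Hnorm_nonneg (b1, b2, b3)
  generalize Hnorm (a1, a2, a3) = A at *
  generalize Hnorm (b1, b2, b3) = B at *
  simp only at hp1 hp2 hq1 hq2
  have hAB : 0 ≤ A * B := mul_nonneg hA hB
  have key : (a1 ^ 2 + a2 ^ 2) * (b1 ^ 2 + b2 ^ 2) ≤ A ^ 2 * B ^ 2 :=
    mul_le_mul hp1 hq1 (by positivity) (by positivity)
  have c1 : |a1 * b1 + a2 * b2| ≤ A * B := by
    apply abs_le_of_sq_le_sq _ hAB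
    nlinarith [sq_nonneg (a1 * b2 - b1 * a2)]
  have c2 : |a1 * b2 - b1 * a2| ≤ A * B := by
    apply abs_le_of_sq_le_sq _ hAB
    nlinarith [sq_nonneg (a1 * b1 + a2 * b2)]
  rw [abs_le] at c1 c2 hp2 hq2
  apply Hnorm_le_of (by linarith)
  · simp only [Hmul]
    nlinarith
  · simp only [Hmul]
    rw [abs_le]
    constructor <;> nlinarith

lemma dH_triangle (p q r : Hei) : dH p r ≤ dH p q + dH q r := by
  have : Hmul (Hinv r) p = Hmul (Hmul (Hinv r) q) (Hmul (Hinv q) p) := by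
    simp only [Hmul, Hinv]
    ext <;> simp only <;> ring
  unfold dH
  rw [this, add_comm]
  exact Hnorm_mul_le _ _

set_option maxHeartbeats 2000000 in
/-- Discrete straightness: small second differences imply closeness to a horizontal line. -/
lemma discrete_line (M s η D : ℝ) (n : ℕ) (hM : 1 ≤ M) (hs : 0 < s) (hη : 0 ≤ η)
    (hn : 4 * (n : ℝ) ^ 2 * η ≤ 1) (hn1 : 1 ≤ n) (hD0 : 0 ≤ D)
    (hD : 2 * n * M ^ 2 * s ^ 2 ≤ D ^ 2) (γ : ℕ → Hei)
    (hγ : ∀ j, dH (γ (j + 1)) (γ j) ≤ M * s)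
    (hx : ∀ j < n, |(γ (j + 2)).1 - 2 * (γ (j + 1)).1 + (γ j).1| ≤ η * s)
    (hy : ∀ j < n, |(γ (j + 2)).2.1 - 2 * (γ (j + 1)).2.1 + (γ j).2.1| ≤ η * s) :
    ∀ j ≤ n, dH (γ j) (Hmul (γ 0) (j * ((γ 1).1 - (γ 0).1),
      j * ((γ 1).2.1 - (γ 0).2.1), 0)) ≤ D := by
  have hnR : (1 : ℝ) ≤ n := by exact_mod_cast hn1
  have hMs : 0 ≤ M * s := by positivity
  have hinc : ∀ j, ((γ (j + 1)).1 - (γ j).1) ^ 2 + ((γ (j + 1)).2.1 - (γ j).2.1) ^ 2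
        ≤ (M * s) ^ 2 ∧
      |(γ (j + 1)).2.2 - (γ j).2.2 - ((γ j).1 * (γ (j + 1)).2.1
        - (γ (j + 1)).1 * (γ j).2.1) / 2| ≤ (M * s) ^ 2 := by
    intro j
    obtain ⟨h1, h2⟩ := Hnorm_le_imp (hγ j)
    simp only [Hmul, Hinv] at h1 h2
    constructor
    · convert h1 using 1; ring
    · convert h2 using 2; ring
  set u0 := (γ 1).1 - (γ 0).1 with hu0
  set v0 := (γ 1).2.1 - (γ 0).2.1 with hv0
  have hu0b : |u0| ≤ M * s := by
    apply abs_le_of_sq_le_sq _ hMs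
    have := (hinc 0).1
    simp only [zero_add] at this
    nlinarith [sq_nonneg v0]
  have hv0b : |v0| ≤ M * s := by
    apply abs_le_of_sq_le_sq _ hMs
    have := (hinc 0).1
    simp only [zero_add] at this
    nlinarith [sq_nonneg u0]
  -- increments
  have hu : ∀ j ≤ n, |(γ (j + 1)).1 - (γ j).1 - u0| ≤ j * (η * s) ∧
      |(γ (j + 1)).2.1 - (γ j).2.1 - v0| ≤ j * (η * s) := by
    intro j
    induction j with
    | zero => intro _; simp [hu0, hv0]
    | succ j ih =>
      intro hj
      obtain ⟨i1, i2⟩ := ih (by omega)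
      have a1 := hx j (by omega)
      have a2 := hy j (by omega)
      rw [abs_le] at *
      push_cast
      refine ⟨⟨?_, ?_⟩, ?_⟩
      · rw [show j + 1 + 1 = j + 2 from rfl]; linarith
      · rw [show j + 1 + 1 = j + 2 from rfl]; linarith
      · rw [show j + 1 + 1 = j + 2 from rfl, abs_le]; constructor <;> linarith
  have hηs : 0 ≤ η * s := by positivity
  have hξ : ∀ j ≤ n, |(γ j).1 - (γ 0).1 - j * u0| ≤ j ^ 2 * (η * s) ∧
      |(γ j).2.1 - (γ 0).2.1 - j * v0| ≤ j ^ 2 * (η * s) := by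
    intro j
    induction j with
    | zero => intro _; simp
    | succ j ih =>
      intro hj
      obtain ⟨i1, i2⟩ := ih (by omega)
      obtain ⟨a1, a2⟩ := hu j (by omega)
      have : 0 ≤ (j : ℝ) * (η * s) := by positivity
      rw [abs_le] at i1 i2 a1 a2
      push_cast
      refine ⟨?_, ?_⟩ <;> rw [abs_le] <;> constructor <;> nlinarith
  -- the vertical coordinate
  set T : ℕ → ℝ := fun j => (γ j).2.2 - (γ 0).2.2
    - ((γ 0).1 * (γ j).2.1 - (γ j).1 * (γ 0).2.1) / 2 with hT
  have hnη : (n : ℝ) * η ≤ 1 := by nlinarith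
  have hTb : ∀ j ≤ n, |T j| ≤ j * ((M * s) ^ 2 + 3 * n ^ 2 * η * M * s ^ 2) := by
    intro j
    induction j with
    | zero => intro _; simp [hT]
    | succ j ih =>
      intro hj
      have ih := ih (by omega)
      obtain ⟨a1, a2⟩ := hu j (by omega)
      obtain ⟨b1, b2⟩ := hξ j (by omega)
      have c := (hinc j).2
      have hjn : (j : ℝ) ≤ n := by exact_mod_cast (by omega : j ≤ n)
      have hj0 : (0 : ℝ) ≤ j := by positivity
      set a := (γ (j + 1)).1 - (γ j).1 - u0
      set b := (γ (j + 1)).2.1 - (γ j).2.1 - v0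
      set ξ := (γ j).1 - (γ 0).1 - j * u0
      set ζ := (γ j).2.1 - (γ 0).2.1 - j * v0
      set τ := (γ (j + 1)).2.2 - (γ j).2.2 - ((γ j).1 * (γ (j + 1)).2.1
        - (γ (j + 1)).1 * (γ j).2.1) / 2
      have e : T (j + 1) = T j + τ + (j * u0 * b + ξ * v0 + ξ * b - u0 * ζ - a * j * v0
          - a * ζ) / 2 := by
        simp only [hT, τ, a, b, ξ, ζ]; ring
      have A1 : |a| ≤ n * (η * s) := a1.trans (by gcongr)
      have A2 : |b| ≤ n * (η * s) := a2.trans (by gcongr)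
      have B1 : |ξ| ≤ n ^ 2 * (η * s) := b1.trans (by gcongr)
      have B2 : |ζ| ≤ n ^ 2 * (η * s) := b2.trans (by gcongr)
      have A3 : n * (η * s) ≤ M * s := by
        have := mul_le_mul_of_nonneg_right (hnη.trans hM) hs.le
        linarith
      set X := (n : ℝ) ^ 2 * η * M * s ^ 2 with hX
      have t1 : |j * u0 * b| ≤ X := by
        rw [abs_mul, abs_mul, abs_of_nonneg hj0]
        calc (j : ℝ) * |u0| * |b| ≤ n * (M * s) * (n * (η * s)) := by gcongr
          _ = X := by rw [hX]; ring
      have t2 : |ξ * v0| ≤ X := by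
        rw [abs_mul]
        calc |ξ| * |v0| ≤ n ^ 2 * (η * s) * (M * s) := by gcongr
          _ = X := by rw [hX]; ring
      have t3 : |ξ * b| ≤ X := by
        rw [abs_mul]
        calc |ξ| * |b| ≤ n ^ 2 * (η * s) * (M * s) := by gcongr; exact A2.trans A3
          _ = X := by rw [hX]; ring
      have t4 : |u0 * ζ| ≤ X := by
        rw [abs_mul]
        calc |u0| * |ζ| ≤ (M * s) * (n ^ 2 * (η * s)) := by gcongr
          _ = X := by rw [hX]; ring
      have t5 : |a * j * v0| ≤ X := by
        rw [abs_mul, abs_mul, abs_of_nonneg hj0]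
        calc |a| * j * |v0| ≤ (n * (η * s)) * n * (M * s) := by gcongr
          _ = X := by rw [hX]; ring
      have t6 : |a * ζ| ≤ X := by
        rw [abs_mul]
        calc |a| * |ζ| ≤ (M * s) * (n ^ 2 * (η * s)) := by gcongr; exact A1.trans A3
          _ = X := by rw [hX]; ring
      rw [e]
      push_cast
      have e2 : 3 * (n : ℝ) ^ 2 * η * M * s ^ 2 = 3 * X := by rw [hX]; ring
      rw [e2] at ih ⊢
      rw [abs_le] at t1 t2 t3 t4 t5 t6 c ih ⊢
      constructor <;> linarith
  intro j hj
  obtain ⟨b1, b2⟩ := hξ j hj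
  have ht := hTb j hj
  have hjn : (j : ℝ) ≤ n := by exact_mod_cast hj
  set ξ := (γ j).1 - (γ 0).1 - j * u0 with hξd
  set ζ := (γ j).2.1 - (γ 0).2.1 - j * v0 with hζd
  have hq : (n : ℝ) ^ 2 * (η * s) ≤ s / 4 := by
    have := mul_le_mul_of_nonneg_right hn hs.le
    linarith
  have B1 : |ξ| ≤ s / 4 := (b1.trans (by gcongr)).trans hq
  have B2 : |ζ| ≤ s / 4 := (b2.trans (by gcongr)).trans hq
  have hM2 : M ≤ M ^ 2 := by nlinarith
  have hs2 : 0 ≤ s ^ 2 := by positivity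
  have hkey : s ^ 2 ≤ n * M ^ 2 * s ^ 2 := by
    have : (1 : ℝ) ≤ n * M ^ 2 := by nlinarith
    nlinarith
  apply Hnorm_le_of hD0
  · simp only [Hmul, Hinv]
    have e1 : -((γ 0).1 + j * u0) + (γ j).1 = ξ := by rw [hξd]; ring
    have e2 : -((γ 0).2.1 + j * v0) + (γ j).2.1 = ζ := by rw [hζd]; ring
    rw [e1, e2]
    have : ξ ^ 2 ≤ (s / 4) ^ 2 := sq_le_sq' (abs_le.1 B1).1 (abs_le.1 B1).2
    have : ζ ^ 2 ≤ (s / 4) ^ 2 := sq_le_sq' (abs_le.1 B2).1 (abs_le.1 B2).2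
    nlinarith
  · simp only [Hmul, Hinv]
    have e : -((γ 0).2.2 + 0 + ((γ 0).1 * (j * v0) - j * u0 * (γ 0).2.1) / 2) + (γ j).2.2 +
        (-((γ 0).1 + j * u0) * (γ j).2.1 - (γ j).1 * -((γ 0).2.1 + j * v0)) / 2
        = T j + (j * ξ * v0 - j * u0 * ζ) / 2 := by
      simp only [hT, hξd, hζd]; ring
    rw [e]
    have s1 : |j * ξ * v0| ≤ n * (s / 4) * (M * s) := by
      rw [abs_mul, abs_mul, Nat.abs_cast]; gcongr
    have s2 : |j * u0 * ζ| ≤ n * (M * s) * (s / 4) := by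
      rw [abs_mul, abs_mul, Nat.abs_cast]; gcongr
    have hms2 : M * s ^ 2 ≤ M ^ 2 * s ^ 2 := by nlinarith
    have hms20 : 0 ≤ M * s ^ 2 := by positivity
    have s3 : |T j| ≤ n * ((M * s) ^ 2 + 3 / 4 * (M * s ^ 2)) := by
      refine ht.trans ?_
      have : 3 * (n : ℝ) ^ 2 * η * M * s ^ 2 ≤ 3 / 4 * (M * s ^ 2) := by
        have := mul_le_mul_of_nonneg_right hn hms20
        linarith
      gcongr
    have : |T j + (j * ξ * v0 - j * u0 * ζ) / 2| ≤ n * ((M * s) ^ 2 + (M * s ^ 2)) := by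
      rw [abs_le] at s1 s2 s3 ⊢
      constructor <;> nlinarith
    refine this.trans (le_trans ?_ hD)
    nlinarith

/-- Second difference in the horizontal direction. -/
noncomputable def sd (φ : ℝ × ℝ → ℝ) (s : ℝ) (w : ℝ × ℝ) : ℝ :=
  φ (w.1 + 2 * s, w.2) - 2 * φ (w.1 + s, w.2) + φ (w.1, w.2)

/-- Lipschitz with respect to the parabolic metric. -/
def PLip (M : ℝ) (φ : ℝ × ℝ → ℝ) : Prop := ∀ w w', |φ w - φ w'| ≤ M * dPar w w'

lemma plip_fst {M : ℝ} {f : ℝ × ℝ → Hei} (hf : IsBilipschitz M f) :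
    PLip M (fun w => (f w).1) := by
  intro w w'
  have h := (hf w w').2
  have h0 : 0 ≤ dH (f w) (f w') := Hnorm_nonneg _
  obtain ⟨h1, -⟩ := Hnorm_le_imp h
  apply abs_le_of_sq_le_sq _ (h0.trans h)
  simp only [Hmul, Hinv] at h1
  nlinarith [sq_nonneg (-(f w').2.1 + (f w).2.1)]

lemma plip_snd {M : ℝ} {f : ℝ × ℝ → Hei} (hf : IsBilipschitz M f) :
    PLip M (fun w => (f w).2.1) := by
  intro w w'
  have h := (hf w w').2
  have h0 : 0 ≤ dH (f w) (f w') := Hnorm_nonneg _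
  obtain ⟨h1, -⟩ := Hnorm_le_imp h
  apply abs_le_of_sq_le_sq _ (h0.trans h)
  simp only [Hmul, Hinv] at h1
  nlinarith [sq_nonneg (-(f w').1 + (f w).1)]

lemma exists_bad (M ε C : ℝ) (hM : 1 ≤ M) (hε : 0 < ε) (hε1 : ε ≤ 1) (hC : 1 ≤ C) (K c0 : ℕ)
    (hK : 96 * M ^ 2 ≤ ε ^ 2 * K) (hc : 2 * C ≤ c0) (hc' : (c0 : ℝ) ≤ 3 * C)
    (f : ℝ × ℝ → Hei) (hf : IsBilipschitz M f) (c : ℝ × ℝ) (r : ℝ) (hr : 0 < r)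
    (hbad : ε ≤ rulerCoef f c (C * r)) :
    ∃ t : ℝ, ∃ j : ℕ, |t - c.2| ≤ (C * r) ^ 2 ∧ j < c0 * K ∧
      (1 / (4 * ((c0 * K : ℕ) : ℝ) ^ 2) * (r / K) <
          |sd (fun w => (f w).1) (r / K) (c.1 - C * r + j * (r / K), t)| ∨
       1 / (4 * ((c0 * K : ℕ) : ℝ) ^ 2) * (r / K) <
          |sd (fun w => (f w).2.1) (r / K) (c.1 - C * r + j * (r / K), t)|) := by
  by_contra hcon
  push Not at hcon
  have hKpos : (0 : ℝ) < K := by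
    have : 0 < ε ^ 2 * (K : ℝ) := by nlinarith
    exact pos_of_mul_pos_right this (by positivity)
  have hc0 : (0 : ℝ) < c0 := by linarith
  set s := r / K with hs
  have hspos : 0 < s := by positivity
  have hsK : s * K = r := by rw [hs]; field_simp
  set n := c0 * K with hn
  have hnR : (n : ℝ) = c0 * K := by rw [hn]; push_cast; ring
  have hnpos : (0 : ℝ) < n := by rw [hnR]; positivity
  have hn1 : 1 ≤ n := by exact_mod_cast hnpos
  have hmem : ε / 2 ∈ {ρ : ℝ | 0 < ρ ∧ ∀ t : ℝ, ∃ L : Set Hei, IsHorizontalLine L ∧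
    f '' (lineW t ∩ BPar c (C * r)) ⊆ NH L (ρ * (C * r))} := by
    refine ⟨by positivity, fun t => ?_⟩
    by_cases ht : |t - c.2| ≤ (C * r) ^ 2
    · set a := c.1 - C * r with ha
      set γ : ℕ → Hei := fun j => f (a + j * s, t) with hγd
      have hγ : ∀ j, dH (γ (j + 1)) (γ j) ≤ M * s := by
        intro j
        refine (hf _ _).2.trans ?_
        have : dPar (a + ((j + 1 : ℕ) : ℝ) * s, t) (a + j * s, t) ≤ s := by
          unfold dPar
          apply max_le
          · simp only
            push_cast
            rw [show a + ((j : ℝ) + 1) * s - (a + j * s) = s by ring, abs_of_pos hspos]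
          · simp [hspos.le]
        gcongr
      have e1 : ∀ j : ℕ, a + j * s + 2 * s = a + ((j + 2 : ℕ) : ℝ) * s := by
        intro j; push_cast; ring
      have e2 : ∀ j : ℕ, a + j * s + s = a + ((j + 1 : ℕ) : ℝ) * s := by
        intro j; push_cast; ring
      set D := ε * (C * r) / 4 with hD
      have hD0 : 0 ≤ D := by positivity
      have hrK : 96 * M ^ 2 * s ≤ ε ^ 2 * r := by
        rw [← hsK]; nlinarith
      have hDD : 2 * n * M ^ 2 * s ^ 2 ≤ D ^ 2 := by
        have h1 : 2 * (n : ℝ) * M ^ 2 * s ^ 2 = 2 * c0 * M ^ 2 * s * r := by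
          rw [hnR, ← hsK]; ring
        rw [h1]
        have h2 : 2 * (c0 : ℝ) * M ^ 2 * s * r ≤ 2 * (3 * C) * M ^ 2 * s * r := by gcongr
        have h3 : 2 * (3 * C) * M ^ 2 * s * r = C * r / 16 * (96 * M ^ 2 * s) := by ring
        have h4 : C * r / 16 * (96 * M ^ 2 * s) ≤ C * r / 16 * (ε ^ 2 * r) := by gcongr
        have h5 : C * r / 16 * (ε ^ 2 * r) ≤ C * r / 16 * (ε ^ 2 * (C * r)) := by
          gcongr; nlinarith
        have h6 : C * r / 16 * (ε ^ 2 * (C * r)) = D ^ 2 := by rw [hD]; ring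
        linarith
      have hMD : M * s ≤ D := by
        have h1 : M * (M * s) ≤ M * (ε * r / 96) := by
          have : ε ^ 2 * r ≤ ε * r * M := by
            have : ε * ε ≤ ε * M := by gcongr; linarith
            nlinarith
          nlinarith
        have h2 : M * s ≤ ε * r / 96 := le_of_mul_le_mul_left h1 (by linarith)
        have h3 : ε * r ≤ ε * (C * r) := by gcongr; nlinarith
        have h4 : 0 ≤ ε * r := by positivity
        rw [hD]; linarith
      have key := discrete_line M s (1 / (4 * (n : ℝ) ^ 2)) D n hM hspos (by positivity)
        (le_of_eq (by field_simp)) hn1 hD0 hDD γ hγ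
        (by
          intro j hj
          have := (hcon t j ht hj).1
          simp only [sd] at this
          rw [e1, e2] at this
          exact this)
        (by
          intro j hj
          have := (hcon t j ht hj).2
          simp only [sd] at this
          rw [e1, e2] at this
          exact this)
      set u0 := (γ 1).1 - (γ 0).1
      set v0 := (γ 1).2.1 - (γ 0).2.1
      obtain ⟨v, hv0, σ, hv⟩ : ∃ v : ℝ × ℝ, v ≠ 0 ∧ ∃ σ : ℝ, u0 = σ * v.1 ∧ v0 = σ * v.2 := by
        by_cases h : ((u0, v0) : ℝ × ℝ) = 0
        · refine ⟨(1, 0), by simp, 0, ?_⟩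
          simpa using h
        · exact ⟨(u0, v0), h, 1, by simp⟩
      refine ⟨{q | ∃ x : ℝ, q = Hmul (γ 0) (x * v.1, x * v.2, 0)}, ⟨γ 0, v, hv0, rfl⟩, ?_⟩
      rintro _ ⟨⟨y, t'⟩, ⟨hl, hb⟩, rfl⟩
      simp only [lineW, Set.mem_ofPred_eq] at hl
      subst hl
      have hy : |y - c.1| ≤ C * r := (le_max_left _ _).trans hb
      rw [abs_le] at hy
      have hya : 0 ≤ y - a := by rw [ha]; linarith
      set j := ⌊(y - a) / s⌋₊ with hj
      have hj1 : (j : ℝ) ≤ (y - a) / s := Nat.floor_le (by positivity)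
      have hj2 : (y - a) / s < j + 1 := Nat.lt_floor_add_one _
      rw [le_div_iff₀ hspos] at hj1
      rw [div_lt_iff₀ hspos] at hj2
      have hjn : j ≤ n := by
        have : (j : ℝ) * s ≤ n * s := by
          rw [hnR, mul_assoc, mul_comm (K : ℝ) s, hsK]
          have : 2 * C * r ≤ c0 * r := by gcongr
          linarith
        exact_mod_cast le_of_mul_le_mul_right this hspos
      have hkj := key j hjn
      have hm : dH (f (y, t')) (Hmul (γ 0) (j * σ * v.1, j * σ * v.2, 0)) ∈ dH (f (y, t')) ''
          {q | ∃ x : ℝ, q = Hmul (γ 0) (x * v.1, x * v.2, 0)} := ⟨_, ⟨j * σ, rfl⟩, rfl⟩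
      refine le_trans (csInf_le ⟨0, ?_⟩ hm) ?_
      · rintro _ ⟨q, -, rfl⟩
        exact Hnorm_nonneg _
      · rw [mul_assoc, mul_assoc, ← hv.1, ← hv.2]
        refine (dH_triangle _ (γ j) _).trans ?_
        have : dH (f (y, t')) (γ j) ≤ M * s := by
          refine (hf _ _).2.trans ?_
          have : dPar (y, t') (a + j * s, t') ≤ s := by
            unfold dPar
            apply max_le
            · simp only
              rw [abs_le]; constructor <;> linarith
            · simp [hspos.le]
          gcongr
        have : ε / 2 * (C * r) = D + D := by rw [hD]; ring
        linarith
    · refine ⟨{q | ∃ x : ℝ, q = Hmul (0, 0, 0) (x * 1, x * 0, 0)},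
        ⟨(0, 0, 0), (1, 0), by simp, rfl⟩, ?_⟩
      rintro _ ⟨⟨y, t'⟩, ⟨hl, hb⟩, rfl⟩
      simp only [lineW, Set.mem_ofPred_eq] at hl
      subst hl
      exfalso
      apply ht
      have : Real.sqrt |t' - c.2| ≤ C * r := (le_max_right _ _).trans hb
      exact (Real.sqrt_le_iff.1 this).2
  have : rulerCoef f c (C * r) ≤ ε / 2 := csInf_le ⟨0, fun ρ h => h.1.le⟩ hmem
  linarith

open MeasureTheory in
lemma PLip.continuous {M : ℝ} {φ : ℝ × ℝ → ℝ} (h : PLip M φ) : Continuous φ := by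
  rw [continuous_iff_continuousAt]
  intro w
  rw [ContinuousAt, tendsto_iff_dist_tendsto_zero]
  refine squeeze_zero (fun _ => dist_nonneg) (fun w' => h w' w) ?_
  have : Continuous (fun w' => M * dPar w' w) := by unfold dPar; fun_prop
  have h2 := this.tendsto w
  simpa [dPar] using h2

/-- Difference quotient. -/
noncomputable def dq (φ : ℝ × ℝ → ℝ) (r : ℝ) (w : ℝ × ℝ) : ℝ :=
  (φ (w.1 + r, w.2) - φ (w.1, w.2)) / r

/-- Squared normalised second difference. -/
noncomputable def gg (φ : ℝ × ℝ → ℝ) (s : ℝ) (w : ℝ × ℝ) : ℝ≥0∞ :=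
  ENNReal.ofReal ((sd φ s w / s) ^ 2)

/-- Squared difference quotient. -/
noncomputable def ee (φ : ℝ × ℝ → ℝ) (s : ℝ) (w : ℝ × ℝ) : ℝ≥0∞ :=
  ENNReal.ofReal ((dq φ s w) ^ 2)

lemma measurable_gg {φ : ℝ × ℝ → ℝ} (h : Continuous φ) (s : ℝ) : Measurable (gg φ s) := by
  unfold gg sd
  apply Measurable.ennreal_ofReal
  apply Continuous.measurable
  fun_prop

lemma measurable_ee {φ : ℝ × ℝ → ℝ} (h : Continuous φ) (s : ℝ) : Measurable (ee φ s) := by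
  unfold ee dq
  apply Measurable.ennreal_ofReal
  apply Continuous.measurable
  fun_prop

lemma ee_gg (φ : ℝ × ℝ → ℝ) (r : ℝ) (hr : 0 < r) (w : ℝ × ℝ) :
    gg φ r w + 4 * ee φ (2 * r) w = 2 * ee φ r w + 2 * ee φ r (w + (r, 0)) := by
  unfold gg ee
  rw [show (4 : ℝ≥0∞) = ENNReal.ofReal 4 by simp, show (2 : ℝ≥0∞) = ENNReal.ofReal 2 by simp,
    ← ENNReal.ofReal_mul (by norm_num), ← ENNReal.ofReal_mul (by norm_num),
    ← ENNReal.ofReal_mul (by norm_num), ← ENNReal.ofReal_add (by positivity) (by positivity),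
    ← ENNReal.ofReal_add (by positivity) (by positivity)]
  congr 1
  simp only [sd, dq, Prod.fst_add, Prod.snd_add, add_zero]
  rw [show w.1 + r + r = w.1 + 2 * r by ring]
  field_simp
  ring

open MeasureTheory in
lemma energy_step {φ : ℝ × ℝ → ℝ} (h : Continuous φ) (r : ℝ) (hr : 0 < r) (A A' : Set (ℝ × ℝ))
    (hA : MeasurableSet A) (hA' : MeasurableSet A')
    (h1 : A ⊆ A') (h2 : ∀ w ∈ A, w + (r, 0) ∈ A') :
    (∫⁻ w in A, gg φ r w) + 4 * ∫⁻ w in A, ee φ (2 * r) w ≤ 4 * ∫⁻ w in A', ee φ r w := by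
  rw [← lintegral_const_mul _ (measurable_ee h _), ← lintegral_add_left (measurable_gg h _)]
  simp_rw [ee_gg φ r hr]
  rw [lintegral_add_left ((measurable_ee h _).const_mul _),
    lintegral_const_mul _ (measurable_ee h _),
    lintegral_const_mul (μ := volume.restrict A) (2 : ℝ≥0∞)
      (show Measurable (fun w : ℝ × ℝ => ee φ r (w + (r, 0))) from
        (measurable_ee h _).comp (measurable_add_const _))]
  have i1 : ∫⁻ w in A, ee φ r w ≤ ∫⁻ w in A', ee φ r w := lintegral_mono_set h1
  have i2 : ∫⁻ w in A, ee φ r (w + (r, 0)) ≤ ∫⁻ w in A', ee φ r w := by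
    rw [← lintegral_indicator hA, ← lintegral_indicator hA',
      ← lintegral_add_right_eq_self (A'.indicator (ee φ r)) ((r, 0) : ℝ × ℝ)]
    apply lintegral_mono
    intro w
    by_cases hw : w ∈ A
    · simp [hw, h2 w hw]
    · simp [hw]
  calc _ ≤ 2 * (∫⁻ w in A', ee φ r w) + 2 * (∫⁻ w in A', ee φ r w) := by gcongr
    _ = _ := by rw [← add_mul]; norm_num

lemma ee_le {φ : ℝ × ℝ → ℝ} {M : ℝ} (h : PLip M φ) (r : ℝ) (hr : 0 < r) (w : ℝ × ℝ) :
    ee φ r w ≤ ENNReal.ofReal (M ^ 2) := by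
  apply ENNReal.ofReal_le_ofReal
  have := h (w.1 + r, w.2) (w.1, w.2)
  have hd : dPar (w.1 + r, w.2) (w.1, w.2) = r := by
    simp [dPar, abs_of_pos hr, hr.le]
  rw [hd] at this
  have hq : |dq φ r w| ≤ M := by
    rw [dq, abs_div, abs_of_pos hr, div_le_iff₀ hr]
    exact this
  exact sq_le_sq' (abs_le.1 hq).1 (abs_le.1 hq).2

open MeasureTheory in
lemma carl {φ : ℝ × ℝ → ℝ} {M : ℝ} (h : PLip M φ) (a b c d s0 : ℝ) (hs0 : 0 < s0) :
    ∑' m : ℕ, ∫⁻ w in Set.Icc a b ×ˢ Set.Icc c d, gg φ (s0 / 2 ^ m) w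
      ≤ 4 * (ENNReal.ofReal (M ^ 2) * volume (Set.Icc a (b + 4 * s0) ×ˢ Set.Icc c d)) := by
  set W : ℝ → Set (ℝ × ℝ) := fun r => Set.Icc a (b + 4 * s0 - 2 * r) ×ˢ Set.Icc c d with hW
  have hWm : ∀ r, MeasurableSet (W r) := fun r => measurableSet_Icc.prod measurableSet_Icc
  have hsm : ∀ m : ℕ, 0 < s0 / 2 ^ m := fun m => by positivity
  have hsle : ∀ m : ℕ, s0 / 2 ^ m ≤ s0 := fun m =>
    div_le_self hs0.le (one_le_pow₀ (by norm_num))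
  have claim : ∀ k : ℕ, ∑ m ∈ Finset.range k, ∫⁻ w in Set.Icc a b ×ˢ Set.Icc c d,
      gg φ (s0 / 2 ^ m) w ≤ 4 * ∫⁻ w in W (2 * (s0 / 2 ^ k)), ee φ (2 * (s0 / 2 ^ k)) w := by
    intro k
    induction k with
    | zero => simp
    | succ k ih =>
      rw [Finset.sum_range_succ]
      have e : 2 * (s0 / 2 ^ (k + 1)) = s0 / 2 ^ k := by rw [pow_succ]; field_simp
      rw [e]
      have st := energy_step h.continuous (s0 / 2 ^ k) (hsm k) (W (2 * (s0 / 2 ^ k)))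
        (W (s0 / 2 ^ k)) (hWm _) (hWm _)
        (by
          rintro ⟨x, t⟩ ⟨⟨p1, p2⟩, hq⟩
          have := hsm k
          simp only at p1 p2
          exact ⟨⟨p1, by simp only; linarith⟩, hq⟩)
        (by
          rintro ⟨x, t⟩ ⟨⟨p1, p2⟩, hq⟩
          have := hsm k
          simp only at p1 p2
          refine ⟨⟨by simp only [Prod.fst_add]; linarith, by simp only [Prod.fst_add]; linarith⟩,
            by simpa using hq⟩)
      refine le_trans ?_ st
      rw [add_comm]
      refine add_le_add (lintegral_mono_set ?_) ih
      rintro ⟨x, t⟩ ⟨⟨p1, p2⟩, hq⟩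
      have := hsle k
      simp only at p1 p2
      exact ⟨⟨p1, by simp only; linarith⟩, hq⟩
  apply ENNReal.tsum_le_of_sum_range_le
  intro k
  refine (claim k).trans ?_
  gcongr
  calc ∫⁻ w in W (2 * (s0 / 2 ^ k)), ee φ (2 * (s0 / 2 ^ k)) w
      ≤ ∫⁻ _ in W (2 * (s0 / 2 ^ k)), ENNReal.ofReal (M ^ 2) :=
        lintegral_mono (fun w => ee_le h _ (by have := hsm k; linarith) w)
    _ = ENNReal.ofReal (M ^ 2) * volume (W (2 * (s0 / 2 ^ k))) := setLIntegral_const _ _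
    _ ≤ _ := by
      gcongr
      rintro ⟨x, t⟩ ⟨⟨p1, p2⟩, hq⟩
      have := hsm k
      simp only at p1 p2
      exact ⟨⟨p1, by simp only; linarith⟩, hq⟩

open MeasureTheory in
lemma lower_int {φ : ℝ × ℝ → ℝ} {M : ℝ} (hM : 1 ≤ M) (h : PLip M φ) (s η x t : ℝ) (hs : 0 < s)
    (hη : 0 < η) (hsd : η * s < |sd φ s (x, t)|) :
    ENNReal.ofReal ((η / (8 * M)) ^ 3 * η ^ 2 * s ^ 3) ≤
      ∫⁻ w in Set.Icc (x - η / (8 * M) * s) (x + η / (8 * M) * s) ×ˢ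
        Set.Icc (t - (η / (8 * M) * s) ^ 2) (t + (η / (8 * M) * s) ^ 2), gg φ s w := by
  have hM0 : 0 < M := by linarith
  set κ := η / (8 * M) with hκ
  have hκ0 : 0 < κ := by positivity
  have hκM : M * κ = η / 8 := by rw [hκ]; field_simp
  set B := Set.Icc (x - κ * s) (x + κ * s) ×ˢ Set.Icc (t - (κ * s) ^ 2) (t + (κ * s) ^ 2)
  have hB : MeasurableSet B := measurableSet_Icc.prod measurableSet_Icc
  have hvol : volume B = ENNReal.ofReal (4 * κ ^ 3 * s ^ 3) := by
    rw [Measure.volume_eq_prod, Measure.prod_prod, Real.volume_Icc, Real.volume_Icc,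
      ← ENNReal.ofReal_mul (by nlinarith [mul_pos hκ0 hs])]
    congr 1
    ring
  calc ENNReal.ofReal (κ ^ 3 * η ^ 2 * s ^ 3)
      = ENNReal.ofReal (η ^ 2 / 4) * volume B := by
        rw [hvol, ← ENNReal.ofReal_mul (by positivity)]
        congr 1
        ring
    _ = ∫⁻ _ in B, ENNReal.ofReal (η ^ 2 / 4) := (setLIntegral_const _ _).symm
    _ ≤ ∫⁻ w in B, gg φ s w := by
      apply setLIntegral_mono' hB
      rintro ⟨x', t'⟩ ⟨⟨p1, p2⟩, ⟨p3, p4⟩⟩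
      simp only at p1 p2 p3 p4
      apply ENNReal.ofReal_le_ofReal
      have hl : ∀ y, |φ (x' + y, t') - φ (x + y, t)| ≤ η / 8 * s := by
        intro y
        refine (h _ _).trans ?_
        have : dPar (x' + y, t') (x + y, t) ≤ κ * s := by
          unfold dPar
          apply max_le
          · simp only; rw [abs_le]; constructor <;> linarith
          · simp only; rw [Real.sqrt_le_iff]
            refine ⟨by positivity, ?_⟩
            rw [abs_le]; constructor <;> linarith
        calc _ ≤ M * (κ * s) := by gcongr
          _ = _ := by rw [← mul_assoc, hκM]
      have l1 := hl (2 * s)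
      have l2 := hl s
      have l3 := hl 0
      simp only [add_zero] at l3
      have hsd' : η / 2 * s ≤ |sd φ s (x', t')| := by
        have : |sd φ s (x, t)| - |sd φ s (x', t')| ≤ |sd φ s (x, t) - sd φ s (x', t')| :=
          abs_sub_abs_le_abs_sub _ _
        have h3 : |sd φ s (x, t) - sd φ s (x', t')| ≤ η / 2 * s := by
          simp only [sd]
          rw [abs_le] at l1 l2 l3 ⊢
          constructor <;> linarith
        linarith
      have : η / 2 ≤ |sd φ s (x', t') / s| := by
        rw [abs_div, abs_of_pos hs, le_div_iff₀ hs]; exact hsd'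
      rw [← sq_abs (sd φ s (x', t') / s)]
      calc η ^ 2 / 4 = (η / 2) ^ 2 := by ring
        _ ≤ _ := by gcongr

/-- Big box around a rectangle. -/
noncomputable def box (C1 : ℕ) (i : Idx) : Set (ℝ × ℝ) :=
  Set.Icc ((center i).1 - C1 * sideLen i) ((center i).1 + C1 * sideLen i) ×ˢ
  Set.Icc ((center i).2 - (C1 * sideLen i) ^ 2) ((center i).2 + (C1 * sideLen i) ^ 2)

lemma sideLen_pos (i : Idx) : 0 < sideLen i := zpow_pos (by norm_num) _

lemma four_zpow (n : ℤ) : (4 : ℝ) ^ (-n) = ((2 : ℝ) ^ (-n)) ^ 2 := by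
  rw [show (4 : ℝ) = 2 ^ 2 by norm_num, ← zpow_natCast, ← zpow_natCast, ← zpow_mul, ← zpow_mul,
    mul_comm]

lemma measurableSet_box (C1 : ℕ) (i : Idx) : MeasurableSet (box C1 i) :=
  measurableSet_Icc.prod measurableSet_Icc

lemma card_aux (z : ℝ) (c : ℕ) : (Finset.Icc ⌈z - c⌉ ⌊z + c⌋).card ≤ 2 * c + 1 := by
  rw [Int.card_Icc]
  have h1 := Int.floor_le (z + c)
  have h2 := Int.le_ceil (z - c)
  have : ((⌊z + c⌋ - ⌈z - c⌉ : ℤ) : ℝ) ≤ ((2 * c : ℤ) : ℝ) := by push_cast; linarith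
  have : ⌊z + c⌋ - ⌈z - c⌉ ≤ 2 * c := by exact_mod_cast this
  omega

lemma overlap (C1 : ℕ) (n : ℤ) (G : ℝ × ℝ → ℝ≥0∞) (w : ℝ × ℝ) :
    ∑' kl : ℤ × ℤ, (box C1 (n, kl)).indicator G w
      ≤ (((2 * C1 + 1) * (2 * C1 ^ 2 + 1) : ℕ) : ℝ≥0∞) * G w := by
  set r : ℝ := (2 : ℝ) ^ (-n) with hr
  have hr0 : 0 < r := zpow_pos (by norm_num) _
  set F := Finset.Icc ⌈w.1 / r - 1 / 2 - (C1 : ℕ)⌉ ⌊w.1 / r - 1 / 2 + (C1 : ℕ)⌋ ×ˢ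
    Finset.Icc ⌈w.2 / r ^ 2 - 1 / 2 - (C1 ^ 2 : ℕ)⌉ ⌊w.2 / r ^ 2 - 1 / 2 + (C1 ^ 2 : ℕ)⌋ with hF
  rw [tsum_eq_sum (s := F)]
  · calc ∑ kl ∈ F, (box C1 (n, kl)).indicator G w ≤ ∑ kl ∈ F, G w :=
          Finset.sum_le_sum (fun _ _ => Set.indicator_le_self _ _ _)
      _ = (F.card : ℝ≥0∞) * G w := by rw [Finset.sum_const, nsmul_eq_mul]
      _ ≤ _ := by
        gcongr
        rw [hF, Finset.card_product]
        exact Nat.mul_le_mul (card_aux _ _) (card_aux _ _)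
  · rintro ⟨k, l⟩ hkl
    apply Set.indicator_of_notMem
    rintro ⟨⟨p1, p2⟩, ⟨p3, p4⟩⟩
    apply hkl
    simp only [center, sideLen, four_zpow, ← hr] at p1 p2 p3 p4
    simp only [hF, Finset.mem_product, Finset.mem_Icc, Int.ceil_le, Int.le_floor]
    push_cast
    have e1 : w.1 = w.1 / r * r := by field_simp
    have e2 : w.2 = w.2 / r ^ 2 * r ^ 2 := by field_simp
    rw [e1] at p1 p2
    rw [e2] at p3 p4
    have hr2 : 0 < r ^ 2 := by positivity
    refine ⟨⟨?_, ?_⟩, ?_, ?_⟩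
    · have : (w.1 / r - (k + 1 / 2 + C1)) * r ≤ 0 := by linarith
      have := nonpos_of_mul_nonpos_left this hr0
      linarith
    · have : (k + 1 / 2 - C1 - w.1 / r) * r ≤ 0 := by linarith
      have := nonpos_of_mul_nonpos_left this hr0
      linarith
    · have : (w.2 / r ^ 2 - (l + 1 / 2 + C1 ^ 2)) * r ^ 2 ≤ 0 := by linarith
      have := nonpos_of_mul_nonpos_left this hr2
      linarith
    · have : (l + 1 / 2 - C1 ^ 2 - w.2 / r ^ 2) * r ^ 2 ≤ 0 := by linarith
      have := nonpos_of_mul_nonpos_left this hr2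
      linarith

/-- A large region containing all boxes of descendants. -/
noncomputable def bigR (C1 : ℕ) (i : Idx) (e : ℝ) : Set (ℝ × ℝ) :=
  Set.Icc ((center i).1 - (C1 + 1) * sideLen i) ((center i).1 + (C1 + 1) * sideLen i + e) ×ˢ
  Set.Icc ((center i).2 - (C1 ^ 2 + 1) * sideLen i ^ 2)
    ((center i).2 + (C1 ^ 2 + 1) * sideLen i ^ 2)

lemma rect_sub {i j : Idx} (h : rect i ⊆ rect j) :
    j.1 ≤ i.1 ∧ |(center i).1 - (center j).1| ≤ sideLen j ∧
      |(center i).2 - (center j).2| ≤ sideLen j ^ 2 := by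
  obtain ⟨n, k, l⟩ := i
  obtain ⟨n', k', l'⟩ := j
  simp only [rect, center, sideLen, four_zpow] at h ⊢
  have hr0 : (0 : ℝ) < 2 ^ (-n) := zpow_pos (by norm_num) _
  have hr0' : (0 : ℝ) < 2 ^ (-n') := zpow_pos (by norm_num) _
  set r : ℝ := (2 : ℝ) ^ (-n) with hr
  set r' : ℝ := (2 : ℝ) ^ (-n') with hr'
  have hr2 : 0 < r ^ 2 := by positivity
  have hr2' : 0 < r' ^ 2 := by positivity
  have hne : (Set.Ico (k * r) ((k + 1) * r) ×ˢ Set.Ico (l * r ^ 2) ((l + 1) * r ^ 2)).Nonempty :=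
    ⟨(k * r, l * r ^ 2), ⟨by constructor <;> simp only <;> linarith,
      by constructor <;> simp only <;> linarith⟩⟩
  obtain ⟨h1, h2⟩ : _ ∧ _ := by
    rcases Set.prod_subset_prod_iff.1 h with h | h | h
    · exact h
    · simp [h] at hne
    · simp [h] at hne
  rw [Set.Ico_subset_Ico_iff (by linarith)] at h1 h2
  obtain ⟨a1, a2⟩ := h1
  obtain ⟨b1, b2⟩ := h2
  refine ⟨?_, ?_, ?_⟩
  · have : r ≤ r' := by linarith
    rw [hr, hr', zpow_le_zpow_iff_right₀ (by norm_num)] at this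
    omega
  · rw [abs_le]; constructor <;> linarith
  · rw [abs_le]; constructor <;> linarith

lemma sideLen_mono {i j : Idx} (h : j.1 ≤ i.1) : sideLen i ≤ sideLen j := by
  unfold sideLen
  exact zpow_le_zpow_right₀ (by norm_num) (by omega)

lemma box_sub (C1 : ℕ) {i j : Idx} (h : rect i ⊆ rect j) : box C1 i ⊆ bigR C1 j 0 := by
  obtain ⟨h1, h2, h3⟩ := rect_sub h
  have hl := sideLen_mono h1
  have h0 := sideLen_pos i
  have m1 : C1 * sideLen i ≤ C1 * sideLen j := by gcongr
  have m2 : (C1 * sideLen i) ^ 2 ≤ (C1 * sideLen j) ^ 2 := by gcongr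
  rw [mul_pow, mul_pow (C1 : ℝ) (sideLen j)] at m2
  rw [abs_le] at h2 h3
  rintro ⟨x, t⟩ ⟨⟨p1, p2⟩, ⟨p3, p4⟩⟩
  rw [mul_pow] at p3 p4
  simp only at p1 p2 p3 p4
  refine ⟨⟨?_, ?_⟩, ?_, ?_⟩ <;> simp only <;> linarith

open MeasureTheory in
lemma vol_bigR (C1 : ℕ) (i : Idx) (e : ℝ) (he : e ≤ 4 * sideLen i) :
    volume (bigR C1 i e) ≤
      ENNReal.ofReal ((2 * C1 + 6) * (2 * C1 ^ 2 + 2) * sideLen i ^ 3) := by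
  have h0 := sideLen_pos i
  unfold bigR
  rw [Measure.volume_eq_prod, Measure.prod_prod, Real.volume_Icc, Real.volume_Icc]
  calc _ ≤ ENNReal.ofReal ((2 * C1 + 6) * sideLen i) *
        ENNReal.ofReal ((2 * C1 ^ 2 + 2) * sideLen i ^ 2) := by
        gcongr
        · linarith
        · linarith
    _ = _ := by
      rw [← ENNReal.ofReal_mul (by positivity)]
      congr 1
      ring

open MeasureTheory in
lemma packing_sum (C1 : ℕ) (K : ℕ) (hK : 1 ≤ K) (M : ℝ) (φ : ℝ × ℝ → ℝ) (h : PLip M φ) (i₀ : Idx)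
    (S : Set Idx) (hS : ∀ i ∈ S, rect i ⊆ rect i₀) :
    ∑' i : S, ∫⁻ w in box C1 i.val, gg φ (sideLen i.val / K) w ≤
      (((2 * C1 + 1) * (2 * C1 ^ 2 + 1) : ℕ) : ℝ≥0∞) * (4 * (ENNReal.ofReal (M ^ 2) *
        ENNReal.ofReal ((2 * C1 + 6) * (2 * C1 ^ 2 + 2) * sideLen i₀ ^ 3))) := by
  set P : ℝ≥0∞ := (((2 * C1 + 1) * (2 * C1 ^ 2 + 1) : ℕ) : ℝ≥0∞)
  have hKR : (1 : ℝ) ≤ K := by exact_mod_cast hK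
  have hRm : MeasurableSet (bigR C1 i₀ 0) := measurableSet_Icc.prod measurableSet_Icc
  set T : ℤ → ℝ≥0∞ := fun n => ∫⁻ w in bigR C1 i₀ 0, gg φ ((2 : ℝ) ^ (-n) / K) w
  have hgm : ∀ s, Measurable (gg φ s) := measurable_gg h.continuous
  -- reorganise
  calc ∑' i : S, ∫⁻ w in box C1 i.val, gg φ (sideLen i.val / K) w
      = ∑' i : Idx, S.indicator (fun i => ∫⁻ w in box C1 i, gg φ (sideLen i / K) w) i :=
        tsum_subtype S (fun i => ∫⁻ w in box C1 i, gg φ (sideLen i / K) w)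
    _ ≤ ∑' i : Idx, (if i₀.1 ≤ i.1 then
          ∫⁻ w in bigR C1 i₀ 0, (box C1 i).indicator (gg φ ((2 : ℝ) ^ (-i.1) / K)) w else 0) := by
        apply ENNReal.tsum_le_tsum
        intro i
        by_cases hi : i ∈ S
        · rw [Set.indicator_of_mem hi, if_pos (rect_sub (hS i hi)).1,
            lintegral_indicator (measurableSet_box _ _), Measure.restrict_restrict
              (measurableSet_box _ _), Set.inter_eq_left.2 (box_sub C1 (hS i hi))]
          rfl
        · rw [Set.indicator_of_notMem hi]
          exact zero_le
    _ = ∑' n : ℤ, ∑' kl : ℤ × ℤ, (if i₀.1 ≤ n then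
          ∫⁻ w in bigR C1 i₀ 0, (box C1 (n, kl)).indicator (gg φ ((2 : ℝ) ^ (-n) / K)) w else 0) :=
        ENNReal.tsum_prod'
    _ ≤ ∑' n : ℤ, (if i₀.1 ≤ n then P * T n else 0) := by
        apply ENNReal.tsum_le_tsum
        intro n
        split_ifs with hn
        · rw [← lintegral_tsum (fun kl =>
            ((hgm _).indicator (measurableSet_box _ _)).aemeasurable),
            ← lintegral_const_mul _ (hgm _)]
          exact lintegral_mono (fun w => overlap C1 n _ w)
        · simp
    _ = ∑' m : ℕ, P * T (i₀.1 + m) := by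
        have hinj : Function.Injective (fun m : ℕ => i₀.1 + (m : ℤ)) := by
          intro a b hab
          simpa using hab
        rw [← hinj.tsum_eq]
        · apply tsum_congr
          intro m
          rw [if_pos (by omega)]
        · intro n hn
          have : i₀.1 ≤ n := by
            by_contra hcon
            exact hn (if_neg hcon)
          exact ⟨(n - i₀.1).toNat, by simp only; omega⟩
    _ = P * ∑' m : ℕ, T (i₀.1 + m) := ENNReal.tsum_mul_left
    _ ≤ _ := by
        gcongr
        have hs0 : 0 < sideLen i₀ / K := div_pos (sideLen_pos _) (by linarith)
        have := carl h ((center i₀).1 - (C1 + 1) * sideLen i₀)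
          ((center i₀).1 + (C1 + 1) * sideLen i₀ + 0)
          ((center i₀).2 - (C1 ^ 2 + 1) * sideLen i₀ ^ 2)
          ((center i₀).2 + (C1 ^ 2 + 1) * sideLen i₀ ^ 2) (sideLen i₀ / K) hs0
        have hT : ∀ m : ℕ, T (i₀.1 + m) = ∫⁻ w in bigR C1 i₀ 0,
            gg φ (sideLen i₀ / K / 2 ^ m) w := by
          intro m
          have : (2 : ℝ) ^ (-(i₀.1 + (m : ℤ))) / K = sideLen i₀ / K / 2 ^ m := by
            rw [neg_add, zpow_add₀ (by norm_num), sideLen, zpow_neg 2 (m : ℤ), zpow_natCast]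
            field_simp
          simp only [T, this]
        simp_rw [hT]
        refine this.trans ?_
        gcongr
        rw [add_zero]
        exact vol_bigR C1 i₀ (4 * (sideLen i₀ / K)) (by
          have := div_le_self (sideLen_pos i₀).le hKR
          linarith)

open MeasureTheory in
lemma bad_int (M ε C : ℝ) (hM : 1 ≤ M) (hε : 0 < ε) (hε1 : ε ≤ 1) (hC : 1 ≤ C) (K c0 C1 : ℕ)
    (hK : 96 * M ^ 2 ≤ ε ^ 2 * K) (hc : 2 * C ≤ c0) (hc' : (c0 : ℝ) ≤ 2 * C + 1)
    (hC1 : C + 2 ≤ C1) (η : ℝ) (hη : η = 1 / (4 * ((c0 * K : ℕ) : ℝ) ^ 2)) (hK1 : 1 ≤ K)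
    (f : ℝ × ℝ → Hei) (hf : IsBilipschitz M f) (i : Idx)
    (hbad : ε ≤ rulerCoef f (center i) (C * sideLen i)) :
    ENNReal.ofReal ((η / (8 * M)) ^ 3 * η ^ 2 * (sideLen i / K) ^ 3) ≤
      (∫⁻ w in box C1 i, gg (fun w => (f w).1) (sideLen i / K) w) +
      ∫⁻ w in box C1 i, gg (fun w => (f w).2.1) (sideLen i / K) w := by
  have hr := sideLen_pos i
  have hKR : (1 : ℝ) ≤ K := by exact_mod_cast hK1
  have hc0R : (2 : ℝ) ≤ c0 := by linarith
  have hnR : (1 : ℝ) ≤ ((c0 * K : ℕ) : ℝ) := by push_cast; nlinarith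
  have hη0 : 0 < η := by rw [hη]; positivity
  have hη1 : η ≤ 1 := by
    rw [hη, div_le_one (by positivity)]; nlinarith
  obtain ⟨t, j, ht, hj, hd⟩ := exists_bad M ε C hM hε hε1 hC K c0 hK hc (by linarith) f hf
    (center i) (sideLen i) hr hbad
  rw [← hη] at hd
  set r := sideLen i with hrd
  have hs : 0 < r / K := by positivity
  have hsr : r / K ≤ r := div_le_self hr.le hKR
  have hκ1 : η / (8 * M) ≤ 1 := by
    rw [div_le_one (by positivity)]; linarith
  have hκ0 : 0 ≤ η / (8 * M) := by positivity
  have hκs : η / (8 * M) * (r / K) ≤ r := by nlinarith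
  have hκs0 : 0 ≤ η / (8 * M) * (r / K) := by positivity
  have hκs2 : (η / (8 * M) * (r / K)) ^ 2 ≤ r ^ 2 := by gcongr
  have hjs : (j : ℝ) * (r / K) ≤ (2 * C + 1) * r := by
    have h1 : (j : ℝ) ≤ c0 * K := by exact_mod_cast hj.le
    calc (j : ℝ) * (r / K) ≤ c0 * K * (r / K) := by gcongr
      _ = c0 * r := by field_simp
      _ ≤ _ := by gcongr
  have hjs0 : 0 ≤ (j : ℝ) * (r / K) := by positivity
  have hC1r : (C + 2) * r ≤ C1 * r := by gcongr
  have hC1r2 : (C * r) ^ 2 + r ^ 2 ≤ (C1 * r) ^ 2 := by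
    have : ((C + 2) * r) ^ 2 ≤ (C1 * r) ^ 2 := by gcongr
    have : 0 < C * r ^ 2 := by positivity
    nlinarith
  have hsub : Set.Icc ((center i).1 - C * r + j * (r / K) - η / (8 * M) * (r / K))
      ((center i).1 - C * r + j * (r / K) + η / (8 * M) * (r / K)) ×ˢ
        Set.Icc (t - (η / (8 * M) * (r / K)) ^ 2) (t + (η / (8 * M) * (r / K)) ^ 2)
        ⊆ box C1 i := by
    rw [abs_le] at ht
    rintro ⟨x, t'⟩ ⟨⟨p1, p2⟩, ⟨p3, p4⟩⟩
    simp only at p1 p2 p3 p4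
    refine ⟨⟨?_, ?_⟩, ?_, ?_⟩ <;> simp only [← hrd] <;> linarith
  rcases hd with hd | hd
  · exact (lower_int hM (plip_fst hf) _ η _ _ hs hη0 hd).trans
      ((lintegral_mono_set hsub).trans le_self_add)
  · exact (lower_int hM (plip_snd hf) _ η _ _ hs hη0 hd).trans
      ((lintegral_mono_set hsub).trans le_add_self)

/-- **Proposition 3.3.** Carleson packing condition for the ruler coefficients. -/
theorem ruler_coefficient_Carleson_packing (M : ℝ) (hM : 1 ≤ M) :
    ∀ ε : ℝ, 0 < ε → ε ≤ 1 → ∀ C : ℝ, 1 ≤ C → ∃ C' > (0 : ℝ),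
      ∀ f : ℝ × ℝ → Hei, IsBilipschitz M f → ∀ i₀ : Idx,
        (∑' i : {i : Idx // rect i ⊆ rect i₀ ∧
            ε ≤ rulerCoef f (center i) (C * sideLen i)},
          ENNReal.ofReal (sideLen i.val ^ 3)) ≤ ENNReal.ofReal (C' * sideLen i₀ ^ 3) := by
  intro ε hε hε1 C hC
  obtain ⟨K, hK⟩ := exists_nat_ge (96 * M ^ 2 / ε ^ 2)
  rw [div_le_iff₀ (by positivity), mul_comm (K : ℝ)] at hK
  have hKpos : (0 : ℝ) < K := by
    have : 0 < ε ^ 2 * (K : ℝ) := by nlinarith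
    exact pos_of_mul_pos_right this (by positivity)
  have hK1 : 1 ≤ K := by exact_mod_cast hKpos
  obtain ⟨C1, hC1⟩ := exists_nat_ge (C + 2)
  set c0 := ⌈2 * C⌉₊ with hc0
  have hc : 2 * C ≤ c0 := Nat.le_ceil _
  have hc' : (c0 : ℝ) ≤ 2 * C + 1 := (Nat.ceil_lt_add_one (by linarith)).le
  have hc0pos : (0 : ℝ) < c0 := by linarith
  obtain ⟨η, hη⟩ : ∃ η : ℝ, η = 1 / (4 * ((c0 * K : ℕ) : ℝ) ^ 2) := ⟨_, rfl⟩
  have hη0 : 0 < η := by rw [hη]; push_cast; positivity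
  set q : ℝ := (η / (8 * M)) ^ 3 * η ^ 2 / K ^ 3 with hq
  have hM0 : 0 < M := by linarith
  have hq0 : 0 < q := by positivity
  set P : ℕ := (2 * C1 + 1) * (2 * C1 ^ 2 + 1) with hP
  have hP0 : 0 < P := by positivity
  set V : ℝ := (2 * C1 + 6) * (2 * C1 ^ 2 + 2) with hV
  have hV0 : 0 < V := by positivity
  refine ⟨1 / q * (2 * (P * (4 * (M ^ 2 * V)))), by positivity, fun f hf i₀ => ?_⟩
  have hr0 := sideLen_pos i₀
  set S : Set Idx := {i | rect i ⊆ rect i₀ ∧ ε ≤ rulerCoef f (center i) (C * sideLen i)} with hS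
  have hSr : ∀ i ∈ S, rect i ⊆ rect i₀ := fun i hi => hi.1
  have s1 := packing_sum C1 K hK1 M _ (plip_fst hf) i₀ S hSr
  have s2 := packing_sum C1 K hK1 M _ (plip_snd hf) i₀ S hSr
  have hB : ((P : ℕ) : ℝ≥0∞) * (4 * (ENNReal.ofReal (M ^ 2) *
        ENNReal.ofReal (V * sideLen i₀ ^ 3)))
      = ENNReal.ofReal (P * (4 * (M ^ 2 * (V * sideLen i₀ ^ 3)))) := by
    rw [ENNReal.ofReal_mul (p := (P : ℝ)) (by positivity),
      ENNReal.ofReal_mul (p := 4) (by norm_num),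
      ENNReal.ofReal_mul (p := M ^ 2) (by positivity), ENNReal.ofReal_natCast]
    simp
  rw [hB] at s1 s2
  calc ∑' i : S, ENNReal.ofReal (sideLen i.val ^ 3)
      ≤ ∑' i : S, ENNReal.ofReal (1 / q) *
        ((∫⁻ w in box C1 i.val, gg (fun w => (f w).1) (sideLen i.val / K) w) +
        ∫⁻ w in box C1 i.val, gg (fun w => (f w).2.1) (sideLen i.val / K) w) := by
        apply ENNReal.tsum_le_tsum
        intro i
        have := bad_int M ε C hM hε hε1 hC K c0 C1 hK hc hc' hC1 η hη hK1 f hf i.val i.2.2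
        calc ENNReal.ofReal (sideLen i.val ^ 3)
            = ENNReal.ofReal (1 / q) * ENNReal.ofReal
              ((η / (8 * M)) ^ 3 * η ^ 2 * (sideLen i.val / K) ^ 3) := by
              rw [← ENNReal.ofReal_mul (by positivity)]
              congr 1
              rw [hq]
              field_simp
          _ ≤ _ := by gcongr
    _ = ENNReal.ofReal (1 / q) *
        ((∑' i : S, ∫⁻ w in box C1 i.val, gg (fun w => (f w).1) (sideLen i.val / K) w) +
        ∑' i : S, ∫⁻ w in box C1 i.val, gg (fun w => (f w).2.1) (sideLen i.val / K) w) := by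
        rw [ENNReal.tsum_mul_left, ENNReal.tsum_add]
    _ ≤ ENNReal.ofReal (1 / q) * (ENNReal.ofReal (P * (4 * (M ^ 2 * (V * sideLen i₀ ^ 3)))) +
        ENNReal.ofReal (P * (4 * (M ^ 2 * (V * sideLen i₀ ^ 3))))) := by gcongr
    _ = _ := by
        rw [← ENNReal.ofReal_add (by positivity) (by positivity),
          ← ENNReal.ofReal_mul (by positivity)]
        congr 1
        ring

end HeisRug
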